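/- Let d, n ≥ 1. The real vector space of Hermitian operators M on (ℂ^d)^{⊗n} satisfying P_sym^{(d,n)} M P_sym^{(d,n)} = M equals the real linear span of {(|φ⟩⟨φ|)^{⊗n} : φ ∈ ℂ^d a unit vector}. -/

import Mathlib

open Matrix

noncomputable section

/-- The operator `P_d(π)` on `(ℂ^d)^{⊗n}` permuting tensor factors. -/
def permMat (d n : ℕ) (π : Equiv.Perm (Fin n)) :
    Matrix (Fin n → Fin d) (Fin n → Fin d) ℂ :=
  fun a b => if ∀ t, a t = b (π⁻¹ t) then 1 else 0

/-- The symmetrizer `P_sym^{(d,n)} = (1/n!) ∑_{π ∈ S_n} P_d(π)`. -/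
def psym (d n : ℕ) : Matrix (Fin n → Fin d) (Fin n → Fin d) ℂ :=
  (n.factorial : ℂ)⁻¹ • ∑ π : Equiv.Perm (Fin n), permMat d n π

/-- The tensor power `(|φ⟩⟨φ|)^{⊗n}` of the rank-one projector onto `φ`. -/
def outerPow (d n : ℕ) (φ : Fin d → ℂ) :
    Matrix (Fin n → Fin d) (Fin n → Fin d) ℂ :=
  fun a b => (∏ t, φ (a t)) * ∏ t, (starRingEnd ℂ) (φ (b t))

theorem permMat_mul_apply {d n : ℕ} (π : Equiv.Perm (Fin n))
    (A : Matrix (Fin n → Fin d) (Fin n → Fin d) ℂ) (a b : Fin n → Fin d) :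
    (permMat d n π * A) a b = A (a ∘ π) b := by
  rw [Matrix.mul_apply, Finset.sum_eq_single (a ∘ π)]
  · simp [permMat]
  · intro c _ hc
    have : ¬ ∀ t, a t = c (π⁻¹ t) := fun h => hc (by ext t; simp [h])
    simp only [permMat, if_neg this, zero_mul]
  · simp

theorem mul_permMat_apply {d n : ℕ} (π : Equiv.Perm (Fin n))
    (A : Matrix (Fin n → Fin d) (Fin n → Fin d) ℂ) (a b : Fin n → Fin d) :
    (A * permMat d n π) a b = A a (b ∘ ⇑π⁻¹) := by
  rw [Matrix.mul_apply, Finset.sum_eq_single (b ∘ ⇑π⁻¹)]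
  · simp [permMat]
  · intro c _ hc
    have : ¬ ∀ t, c t = b (π⁻¹ t) := fun h => hc (by ext t; simp [h])
    simp only [permMat, if_neg this, mul_zero]
  · simp

theorem permMat_mul_permMat {d n : ℕ} (π σ : Equiv.Perm (Fin n)) :
    permMat d n π * permMat d n σ = permMat d n (π * σ) := by
  ext a b
  rw [permMat_mul_apply]
  have : (∀ t, a (π t) = b (σ⁻¹ t)) ↔ ∀ t, a t = b ((π * σ)⁻¹ t) := by
    rw [← π.forall_congr_right (q := fun t => a t = b ((π * σ)⁻¹ t))]
    simp
  simp only [permMat, Function.comp_apply, this]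

theorem permMat_mul_psym {d n : ℕ} (π : Equiv.Perm (Fin n)) :
    permMat d n π * psym d n = psym d n := by
  simp only [psym, Matrix.mul_smul, Matrix.mul_sum, permMat_mul_permMat]
  congr 1
  exact Fintype.sum_equiv (Equiv.mulLeft π) _ _ fun _ => rfl

theorem psym_mul_permMat {d n : ℕ} (π : Equiv.Perm (Fin n)) :
    psym d n * permMat d n π = psym d n := by
  simp only [psym, Matrix.smul_mul, Matrix.sum_mul, permMat_mul_permMat]
  congr 1
  exact Fintype.sum_equiv (Equiv.mulRight π) _ _ fun _ => rfl

theorem apply_comp_perm_of_psym_mul_mul_psym {d n : ℕ}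
    {M : Matrix (Fin n → Fin d) (Fin n → Fin d) ℂ} (hM : psym d n * M * psym d n = M)
    (π σ : Equiv.Perm (Fin n)) (a b : Fin n → Fin d) : M (a ∘ π) (b ∘ σ) = M a b := by
  have hl : permMat d n π * M = M := by
    rw [← hM, ← Matrix.mul_assoc, ← Matrix.mul_assoc, permMat_mul_psym]
  have hr : M * permMat d n σ⁻¹ = M := by
    rw [← hM, Matrix.mul_assoc, psym_mul_permMat]
  have h := mul_permMat_apply σ⁻¹ M (a ∘ π) b
  rw [inv_inv, hr] at h
  rw [← h, ← permMat_mul_apply π M, hl]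

theorem psym_mul_of_forall_permMat_mul {d n : ℕ}
    {A : Matrix (Fin n → Fin d) (Fin n → Fin d) ℂ} (h : ∀ π, permMat d n π * A = A) :
    psym d n * A = A := by
  simp only [psym, Matrix.smul_mul, Matrix.sum_mul, h, Finset.sum_const, Finset.card_univ,
    Fintype.card_perm, Fintype.card_fin]
  rw [← Nat.cast_smul_eq_nsmul ℂ, smul_smul,
    inv_mul_cancel₀ (Nat.cast_ne_zero.2 n.factorial_ne_zero), one_smul]

theorem mul_psym_of_forall_mul_permMat {d n : ℕ}
    {A : Matrix (Fin n → Fin d) (Fin n → Fin d) ℂ} (h : ∀ π, A * permMat d n π = A) :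
    A * psym d n = A := by
  simp only [psym, Matrix.mul_smul, Matrix.mul_sum, h, Finset.sum_const, Finset.card_univ,
    Fintype.card_perm, Fintype.card_fin]
  rw [← Nat.cast_smul_eq_nsmul ℂ, smul_smul,
    inv_mul_cancel₀ (Nat.cast_ne_zero.2 n.factorial_ne_zero), one_smul]

theorem psym_mul_outerPow_mul_psym {d n : ℕ} (φ : Fin d → ℂ) :
    psym d n * outerPow d n φ * psym d n = outerPow d n φ := by
  rw [psym_mul_of_forall_permMat_mul, mul_psym_of_forall_mul_permMat]
  · intro π
    ext a b
    rw [mul_permMat_apply]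
    simp only [outerPow, Function.comp_apply]
    rw [Equiv.prod_comp π⁻¹ fun t => (starRingEnd ℂ) (φ (b t))]
  · intro π
    ext a b
    rw [permMat_mul_apply]
    simp only [outerPow, Function.comp_apply]
    rw [Equiv.prod_comp π fun t => φ (a t)]

theorem conjTranspose_outerPow {d n : ℕ} (φ : Fin d → ℂ) :
    (outerPow d n φ)ᴴ = outerPow d n φ := by
  ext a b
  simp [outerPow, Matrix.conjTranspose_apply, mul_comm]

theorem outerPow_smul {d n : ℕ} (r : ℝ) (φ : Fin d → ℂ) :
    outerPow d n (fun i => (r : ℂ) * φ i) = (((r ^ n * r ^ n : ℝ)) : ℂ) • outerPow d n φ := by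
  ext a b
  simp [outerPow, Finset.prod_mul_distrib]
  ring

/-- A complex polynomial in `z` and `w` that vanishes whenever `w` is the conjugate of `z`
is zero. -/
theorem MvPolynomial.eq_zero_of_eval_conj_eq_zero {σ : Type*} {F : MvPolynomial (σ ⊕ σ) ℂ}
    (hF : ∀ z : σ → ℂ, MvPolynomial.eval (Sum.elim z fun i => (starRingEnd ℂ) (z i)) F = 0) :
    F = 0 := by
  let g : σ ⊕ σ → MvPolynomial (σ ⊕ σ) ℂ :=
    Sum.elim (fun i => X (Sum.inl i) + C Complex.I * X (Sum.inr i))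
      (fun i => X (Sum.inl i) - C Complex.I * X (Sum.inr i))
  have eval_bind (x : σ ⊕ σ → ℂ) : eval x (bind₁ g F) = eval (fun i => eval x (g i)) F := by
    simp only [eval, eval₂Hom_bind₁]
  have hG : bind₁ g F = 0 := by
    refine MvPolynomial.funext_set (fun _ => Set.range ((↑) : ℝ → ℂ))
      (hs := fun _ => Set.infinite_range_of_injective Complex.ofReal_injective) fun x hx => ?_
    choose y hy using fun i => hx i (Set.mem_univ i)
    rw [map_zero, eval_bind, ← hF fun i => y (Sum.inl i) + Complex.I * y (Sum.inr i)]
    congr 2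
    funext i
    rcases i with i | i <;> simp [g, ← hy, sub_eq_add_neg]
  refine MvPolynomial.funext fun x => ?_
  have h := eval_bind (Sum.elim (fun i => (x (Sum.inl i) + x (Sum.inr i)) / 2)
    (fun i => (x (Sum.inl i) - x (Sum.inr i)) / (2 * Complex.I)))
  rw [hG, map_zero] at h
  rw [map_zero, h]
  congr 2
  funext i
  rcases i with i | i <;> simp [g] <;> field_simp <;> ring

/-- Two tuples with the same number of occurrences of each value agree up to a permutation. -/
theorem exists_perm_comp_eq_of_card_fiber_eq {ι α : Type*} [Fintype ι] [DecidableEq α]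
    {a b : ι → α} (h : ∀ i, Fintype.card {t // a t = i} = Fintype.card {t // b t = i}) :
    ∃ π : Equiv.Perm ι, b ∘ π = a := by
  let e (i : α) : {t // a t = i} ≃ {t // b t = i} := Fintype.equivOfCardEq (h i)
  refine ⟨(Equiv.sigmaFiberEquiv a).symm.trans
    ((Equiv.sigmaCongrRight e).trans (Equiv.sigmaFiberEquiv b)), ?_⟩
  funext t
  exact (e (a t) ⟨t, rfl⟩).2

/-- The exponent of the monomial `∏ t, z (a t) * ∏ t, w (b t)`. -/
def biExponent {d n : ℕ} (p : (Fin n → Fin d) × (Fin n → Fin d)) : Fin d ⊕ Fin d →₀ ℕ :=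
  ∑ t, Finsupp.single (Sum.inl (p.1 t)) 1 + ∑ t, Finsupp.single (Sum.inr (p.2 t)) 1

theorem exists_perm_of_biExponent_eq {d n : ℕ} {p q : (Fin n → Fin d) × (Fin n → Fin d)}
    (h : biExponent p = biExponent q) :
    ∃ π σ : Equiv.Perm (Fin n), q.1 ∘ π = p.1 ∧ q.2 ∘ σ = p.2 := by
  obtain ⟨π, hπ⟩ : ∃ π : Equiv.Perm (Fin n), q.1 ∘ π = p.1 := by
    refine exists_perm_comp_eq_of_card_fiber_eq fun i => ?_
    have := DFunLike.congr_fun h (Sum.inl i)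
    simpa [biExponent, Finsupp.finsetSum_apply, Finsupp.single_apply, Fintype.card_subtype]
      using this
  obtain ⟨σ, hσ⟩ : ∃ σ : Equiv.Perm (Fin n), q.2 ∘ σ = p.2 := by
    refine exists_perm_comp_eq_of_card_fiber_eq fun i => ?_
    have := DFunLike.congr_fun h (Sum.inr i)
    simpa [biExponent, Finsupp.finsetSum_apply, Finsupp.single_apply, Fintype.card_subtype]
      using this
  exact ⟨π, σ, hπ, hσ⟩

theorem eval_monomial_biExponent {d n : ℕ} (p : (Fin n → Fin d) × (Fin n → Fin d)) (c : ℂ)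
    (z w : Fin d → ℂ) :
    MvPolynomial.eval (Sum.elim z w) (MvPolynomial.monomial (biExponent p) c) =
      c * ((∏ t, z (p.1 t)) * ∏ t, w (p.2 t)) := by
  rw [MvPolynomial.eval_monomial, biExponent, Finsupp.prod_add_index' (by simp)
    (by simp [pow_add]), ← Finsupp.prod_finsetSum_index (by simp) (by simp [pow_add]),
    ← Finsupp.prod_finsetSum_index (by simp) (by simp [pow_add])]
  simp

theorem sum_mul_eq_zero_of_sum_mul_outerPow_eq_zero {d n : ℕ}
    {c : (Fin n → Fin d) × (Fin n → Fin d) → ℂ}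
    (hc : ∀ φ : Fin d → ℂ, ∑ p, c p * outerPow d n φ p.1 p.2 = 0)
    {M : Matrix (Fin n → Fin d) (Fin n → Fin d) ℂ} (hM : psym d n * M * psym d n = M) :
    ∑ p, c p * M p.1 p.2 = 0 := by
  have hF : ∑ p, MvPolynomial.monomial (biExponent p) (c p) = 0 := by
    refine MvPolynomial.eq_zero_of_eval_conj_eq_zero fun z => ?_
    simp only [map_sum, eval_monomial_biExponent]
    exact hc z
  rw [← Finset.sum_fiberwise_of_maps_to (t := Finset.univ.image biExponent)
    (g := biExponent) fun p _ => Finset.mem_image_of_mem _ (Finset.mem_univ p)]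
  refine Finset.sum_eq_zero fun m hm => ?_
  obtain ⟨q, -, rfl⟩ := Finset.mem_image.1 hm
  have hq : ∑ p with biExponent p = biExponent q, c p = 0 := by
    have := congrArg (MvPolynomial.coeff (biExponent q)) hF
    simpa [MvPolynomial.coeff_sum, MvPolynomial.coeff_monomial, Finset.sum_filter] using this
  rw [← zero_mul (M q.1 q.2), ← hq, Finset.sum_mul]
  refine Finset.sum_congr rfl fun p hp => ?_
  obtain ⟨π, σ, hπ, hσ⟩ := exists_perm_of_biExponent_eq (Finset.mem_filter.1 hp).2
  rw [← hπ, ← hσ, apply_comp_perm_of_psym_mul_mul_psym hM]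

theorem mem_span_complex_outerPow {d n : ℕ}
    {M : Matrix (Fin n → Fin d) (Fin n → Fin d) ℂ} (hM : psym d n * M * psym d n = M) :
    M ∈ Submodule.span ℂ (Set.range (outerPow d n)) := by
  by_contra hmem
  obtain ⟨f, hfM, hf⟩ := Submodule.exists_le_ker_of_notMem hmem
  have hsum (A : Matrix (Fin n → Fin d) (Fin n → Fin d) ℂ) :
      f A = ∑ p : (Fin n → Fin d) × (Fin n → Fin d),
        f (Matrix.single p.1 p.2 1) * A p.1 p.2 := by
    conv_lhs => rw [Matrix.matrix_eq_sum_single A]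
    simp only [map_sum, Fintype.sum_prod_type]
    refine Finset.sum_congr rfl fun a _ => Finset.sum_congr rfl fun b _ => ?_
    rw [← mul_one (A a b), ← smul_eq_mul, ← Matrix.smul_single, map_smul]
    simp [mul_comm]
  refine hfM ?_
  rw [hsum]
  refine sum_mul_eq_zero_of_sum_mul_outerPow_eq_zero (fun φ => ?_) hM
  rw [← hsum]
  exact hf (Submodule.subset_span ⟨φ, rfl⟩)

/-- The Hermitian part of an element of the complex span of a set of Hermitian matrices lies in
its real span. -/
theorem add_conjTranspose_mem_span_real {m : Type*} {U : Set (Matrix m m ℂ)}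
    (hU : ∀ A ∈ U, Aᴴ = A) {M : Matrix m m ℂ} (hM : M ∈ Submodule.span ℂ U) :
    M + Mᴴ ∈ Submodule.span ℝ U := by
  suffices ∀ c : ℂ, c • M + (c • M)ᴴ ∈ Submodule.span ℝ U by simpa using this 1
  induction hM using Submodule.span_induction with
  | mem A hA =>
    intro c
    have : c • A + (c • A)ᴴ = (2 * c.re) • A := by
      rw [Matrix.conjTranspose_smul, hU A hA, ← add_smul]
      ext i j
      have := Complex.add_conj c
      simp_all
    rw [this]
    exact Submodule.smul_mem _ _ (Submodule.subset_span hA)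
  | zero => simp
  | add A B _ _ hA hB =>
    intro c
    have := Submodule.add_mem _ (hA c) (hB c)
    rwa [add_add_add_comm, ← Matrix.conjTranspose_add, ← smul_add] at this
  | smul r A _ hA =>
    intro c
    rw [smul_smul]
    exact hA _

theorem outerPow_mem_span_unit {d n : ℕ} (hn : 1 ≤ n) (φ : Fin d → ℂ) :
    outerPow d n φ ∈ Submodule.span ℝ
      {M : Matrix (Fin n → Fin d) (Fin n → Fin d) ℂ |
        ∃ φ : Fin d → ℂ, (∑ i, ‖φ i‖ ^ 2 = 1) ∧ M = outerPow d n φ} := by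
  have hs0 : 0 ≤ ∑ i, ‖φ i‖ ^ 2 := by positivity
  rcases hs0.eq_or_lt with hs | hs
  · have hφ (i : Fin d) : φ i = 0 := by
      have := (Finset.sum_eq_zero_iff_of_nonneg fun i _ => sq_nonneg ‖φ i‖).1 hs.symm i
        (Finset.mem_univ i)
      simpa using this
    have : outerPow d n φ = 0 := by
      ext a b
      simp [outerPow, hφ, Nat.ne_of_gt hn]
    rw [this]
    exact Submodule.zero_mem _
  · set r : ℝ := √(∑ i, ‖φ i‖ ^ 2) with hr
    have hr0 : 0 < r := Real.sqrt_pos.2 hs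
    have hr2 : r ^ 2 = ∑ i, ‖φ i‖ ^ 2 := Real.sq_sqrt hs0
    have hφ : φ = fun i => (r : ℂ) * (((r⁻¹ : ℝ) : ℂ) * φ i) := by
      funext i
      have : (r : ℂ) ≠ 0 := by exact_mod_cast hr0.ne'
      push_cast
      field_simp
    rw [hφ, outerPow_smul, Complex.coe_smul]
    refine Submodule.smul_mem _ _ (Submodule.subset_span ⟨_, ?_, rfl⟩)
    simp only [norm_mul, mul_pow, ← Finset.mul_sum, ← hr2, Complex.norm_real, Real.norm_eq_abs,
      sq_abs]
    field_simp

/-- Hermitian operators on the symmetric subspace (self-adjoint `M` with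
`P_sym M P_sym = M`) are exactly the real linear span of
`{(|φ⟩⟨φ|)^{⊗n} : φ a unit vector}`. -/
theorem hermitian_operators_on_sym_subspace_eq_real_span_of_tensor_power_projectors
    (d n : ℕ) (hd : 1 ≤ d) (hn : 1 ≤ n) :
    {M : Matrix (Fin n → Fin d) (Fin n → Fin d) ℂ |
        Mᴴ = M ∧ psym d n * M * psym d n = M} =
      ↑(Submodule.span ℝ
        {M : Matrix (Fin n → Fin d) (Fin n → Fin d) ℂ |
          ∃ φ : Fin d → ℂ, (∑ i, ‖φ i‖ ^ 2 = 1) ∧ M = outerPow d n φ}) := by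
  ext M
  constructor
  · rintro ⟨hH, hP⟩
    have h := add_conjTranspose_mem_span_real
      (by rintro _ ⟨φ, rfl⟩; exact conjTranspose_outerPow φ) (mem_span_complex_outerPow hP)
    rw [hH, ← two_smul ℝ M, Submodule.smul_mem_iff _ two_ne_zero] at h
    refine Submodule.span_le.2 ?_ h
    rintro _ ⟨φ, rfl⟩
    exact outerPow_mem_span_unit hn φ
  · intro hM
    induction (SetLike.mem_coe.1 hM) using Submodule.span_induction with
    | mem A hA =>
      obtain ⟨φ, -, rfl⟩ := hA
      exact ⟨conjTranspose_outerPow φ, psym_mul_outerPow_mul_psym φ⟩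
    | zero => simp
    | add A B hA hB ihA ihB =>
      obtain ⟨hA1, hA2⟩ := ihA hA
      obtain ⟨hB1, hB2⟩ := ihB hB
      exact ⟨by rw [Matrix.conjTranspose_add, hA1, hB1],
        by rw [Matrix.mul_add, Matrix.add_mul, hA2, hB2]⟩
    | smul r A hA ihA =>
      obtain ⟨hA1, hA2⟩ := ihA hA
      exact ⟨by rw [Matrix.conjTranspose_smul, hA1, star_trivial],
        by rw [Matrix.mul_smul, Matrix.smul_mul, hA2]⟩
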